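/- Let v = (x, y, z)ᵀ ∈ 𝕆³ with x ≠ 0 and let λ = [x,y,z] = (xy)z − x(yz). A Jordan matrix A = !![p, a, conj c; conj a, m, b; c, conj b, n] satisfies A v = v λ if and only if conj(a) = (y(λ − m) − b z) · conj(x) · (|x|²)⁻¹, c = (z(λ − n) − conj(b) y) · conj(x) · (|x|²)⁻¹, and the master equation (x(conj(λ) conj(y) − conj(z) conj(b))) y + (x(conj(λ) conj(z) − conj(y) b)) z − x λ |x|² = x (m |y|² + n |z|² − p |x|²) holds. -/

import Mathlib

noncomputable section

/-- The octonions, as the Cayley–Dickson double of the quaternions. -/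
def Octonion : Type := Quaternion ℝ × Quaternion ℝ

namespace Octonion

instance : AddCommGroup Octonion :=
  inferInstanceAs (AddCommGroup (Quaternion ℝ × Quaternion ℝ))

instance : Module ℝ Octonion :=
  inferInstanceAs (Module ℝ (Quaternion ℝ × Quaternion ℝ))

/-- Cayley–Dickson multiplication: (a,b)·(c,d) = (a c − conj(d) b, d a + b conj(c)). -/
instance : Mul Octonion :=
  ⟨fun x y => (x.1 * y.1 - star y.2 * x.2, y.2 * x.1 + x.2 * star y.1)⟩

instance : One Octonion := ⟨((1 : Quaternion ℝ), 0)⟩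

/-- Octonionic conjugation: conj (a,b) = (conj a, −b). -/
def conj (x : Octonion) : Octonion := (star x.1, -x.2)

/-- Real part of an octonion. -/
def re (x : Octonion) : ℝ := x.1.re

/-- Imaginary part of an octonion. -/
def im (x : Octonion) : Octonion := x - re x • 1

/-- Embedding of the reals into the octonions. -/
def ofReal (r : ℝ) : Octonion := (((r : ℝ) : Quaternion ℝ), 0)

/-- The squared norm |w|² (the real scalar such that w · conj w = |w|² · 1). -/
def normSq (x : Octonion) : ℝ := Quaternion.normSq x.1 + Quaternion.normSq x.2

/-- The imaginary unit i. -/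
def i : Octonion := ((⟨0, 1, 0, 0⟩ : Quaternion ℝ), 0)

/-- The imaginary unit j. -/
def j : Octonion := ((⟨0, 0, 1, 0⟩ : Quaternion ℝ), 0)

/-- The imaginary unit k. -/
def k : Octonion := ((⟨0, 0, 0, 1⟩ : Quaternion ℝ), 0)

/-- The imaginary unit ℓ. -/
def l : Octonion := ((0 : Quaternion ℝ), (1 : Quaternion ℝ))

/-- The associator [x,y,z] = (xy)z − x(yz). -/
def assoc (x y z : Octonion) : Octonion := x * y * z - x * (y * z)

/-- A Jordan matrix: a 3×3 Hermitian matrix over the octonions. -/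
def IsHermitian (A : Matrix (Fin 3) (Fin 3) Octonion) : Prop :=
  ∀ p q : Fin 3, conj (A q p) = A p q

/-- The right eigenvalue equation `A v = v λ`, componentwise. -/
def Eig (A : Matrix (Fin 3) (Fin 3) Octonion) (v : Fin 3 → Octonion) (lam : Octonion) : Prop :=
  ∀ p : Fin 3, A p 0 * v 0 + A p 1 * v 1 + A p 2 * v 2 = v p * lam

end Octonion

namespace Octonion

@[ext]
theorem ext {x y : Octonion} (h₁ : x.1 = y.1) (h₂ : x.2 = y.2) : x = y := Prod.ext h₁ h₂

@[simp] theorem fst_zero : (0 : Octonion).1 = 0 := rfl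
@[simp] theorem snd_zero : (0 : Octonion).2 = 0 := rfl
@[simp] theorem fst_add (x y : Octonion) : (x + y).1 = x.1 + y.1 := rfl
@[simp] theorem snd_add (x y : Octonion) : (x + y).2 = x.2 + y.2 := rfl
@[simp] theorem fst_sub (x y : Octonion) : (x - y).1 = x.1 - y.1 := rfl
@[simp] theorem snd_sub (x y : Octonion) : (x - y).2 = x.2 - y.2 := rfl
@[simp] theorem fst_smul (r : ℝ) (x : Octonion) : (r • x).1 = r • x.1 := rfl
@[simp] theorem snd_smul (r : ℝ) (x : Octonion) : (r • x).2 = r • x.2 := rfl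
@[simp] theorem fst_mul (x y : Octonion) : (x * y).1 = x.1 * y.1 - star y.2 * x.2 := rfl
@[simp] theorem snd_mul (x y : Octonion) : (x * y).2 = y.2 * x.1 + x.2 * star y.1 := rfl
@[simp] theorem fst_conj (x : Octonion) : (conj x).1 = star x.1 := rfl
@[simp] theorem snd_conj (x : Octonion) : (conj x).2 = -x.2 := rfl
@[simp] theorem fst_ofReal (r : ℝ) : (ofReal r).1 = (r : Quaternion ℝ) := rfl
@[simp] theorem snd_ofReal (r : ℝ) : (ofReal r).2 = 0 := rfl

/-- Local, so that multiplication in the main theorem elaborates to the original `Mul` instance. -/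
local instance : NonUnitalNonAssocRing Octonion where
  left_distrib x y z := by ext : 1 <;> simp <;> noncomm_ring
  right_distrib x y z := by ext : 1 <;> simp <;> noncomm_ring
  zero_mul x := by ext : 1 <;> simp
  mul_zero x := by ext : 1 <;> simp

instance : IsScalarTower ℝ Octonion Octonion :=
  ⟨fun r x y => by ext : 1 <;> simp [smul_sub, smul_add]⟩

instance : SMulCommClass ℝ Octonion Octonion :=
  ⟨fun r x y => by ext : 1 <;> simp [smul_sub, smul_add]⟩

theorem ofReal_mul (r : ℝ) (x : Octonion) : ofReal r * x = r • x := by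
  ext : 1 <;> simp [Quaternion.coe_mul_eq_smul, Quaternion.mul_coe_eq_smul]

theorem mul_ofReal (x : Octonion) (r : ℝ) : x * ofReal r = r • x := by
  ext : 1 <;> simp [Quaternion.mul_coe_eq_smul]

theorem conj_conj (x : Octonion) : conj (conj x) = x := by
  ext : 1 <;> simp

theorem conj_sub (x y : Octonion) : conj (x - y) = conj x - conj y := by
  ext : 1 <;> simp [neg_add_eq_sub]

theorem conj_smul (r : ℝ) (x : Octonion) : conj (r • x) = r • conj x := by
  ext : 1 <;> simp

theorem conj_mul (x y : Octonion) : conj (x * y) = conj y * conj x := by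
  ext : 1 <;> simp [add_comm]

theorem normSq_conj (x : Octonion) : normSq (conj x) = normSq x := by
  simp [normSq]

theorem normSq_ne_zero {x : Octonion} (hx : x ≠ 0) : normSq x ≠ 0 := by
  contrapose! hx
  have h₁ : 0 ≤ Quaternion.normSq x.1 := Quaternion.normSq_nonneg
  have h₂ : 0 ≤ Quaternion.normSq x.2 := Quaternion.normSq_nonneg
  unfold normSq at hx
  ext1
  · exact Quaternion.normSq_eq_zero.mp (by linarith)
  · exact Quaternion.normSq_eq_zero.mp (by linarith)

theorem mul_mul_conj (x y : Octonion) : x * y * conj y = normSq y • x := by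
  ext <;> simp [normSq, Quaternion.normSq_def'] <;> ring

theorem mul_conj_mul (x y : Octonion) : x * conj y * y = normSq y • x := by
  simpa only [conj_conj, normSq_conj] using mul_mul_conj x (conj y)

/-- Division on the right by a nonzero octonion. -/
theorem mul_eq_iff_eq_smul_mul_conj {x : Octonion} (hx : x ≠ 0) (u w : Octonion) :
    u * x = w ↔ u = (normSq x)⁻¹ • (w * conj x) := by
  have h := normSq_ne_zero hx
  constructor
  · rintro rfl
    rw [mul_mul_conj, inv_smul_smul₀ h]
  · rintro rfl
    rw [smul_mul_assoc, mul_conj_mul, inv_smul_smul₀ h]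

theorem first_row_iff_master {p m n : ℝ} {a b c x y z lam : Octonion} (hx : x ≠ 0)
    (ha : conj a = (normSq x)⁻¹ • ((y * (lam - ofReal m) - b * z) * conj x))
    (hc : c = (normSq x)⁻¹ • ((z * (lam - ofReal n) - conj b * y) * conj x)) :
    ofReal p * x + a * y + conj c * z = x * lam ↔
      (x * (conj lam * conj y - conj z * conj b)) * y +
          (x * (conj lam * conj z - conj y * b)) * z - normSq x • (x * lam) =
        (m * normSq y + n * normSq z - p * normSq x) • x := by
  have h := normSq_ne_zero hx
  have ha' : normSq x • (a * y) =
      x * (conj lam * conj y - conj z * conj b) * y - (m * normSq y) • x := by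
    rw [← conj_conj a, ha]
    simp only [conj_smul, conj_mul, conj_sub, conj_conj, mul_sub, sub_mul, mul_ofReal,
      smul_mul_assoc, smul_inv_smul₀ h, mul_conj_mul, mul_smul]
    abel
  have hc' : normSq x • (conj c * z) =
      x * (conj lam * conj z - conj y * b) * z - (n * normSq z) • x := by
    rw [hc]
    simp only [conj_smul, conj_mul, conj_sub, conj_conj, mul_sub, sub_mul, mul_ofReal,
      smul_mul_assoc, smul_inv_smul₀ h, mul_conj_mul, mul_smul]
    abel
  rw [← smul_right_inj h, smul_add, smul_add, ha', hc', ofReal_mul, smul_smul,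
    mul_comm (normSq x) p, ← sub_eq_zero,
    ← sub_eq_zero (b := (m * normSq y + n * normSq z - p * normSq x) • x)]
  refine Eq.congr ?_ rfl
  simp only [sub_smul, add_smul]
  abel

theorem eig_iff (p m n : ℝ) (a b c x y z lam : Octonion) :
    Eig !![ofReal p, a, conj c; conj a, ofReal m, b; c, conj b, ofReal n] ![x, y, z] lam ↔
      ofReal p * x + a * y + conj c * z = x * lam ∧
      conj a * x = y * (lam - ofReal m) - b * z ∧
      c * x = z * (lam - ofReal n) - conj b * y := by
  simp only [Eig, Fin.forall_fin_succ, IsEmpty.forall_iff, and_true, mul_sub, mul_ofReal]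
  refine and_congr Iff.rfl (and_congr ?_ ?_)
  · change conj a * x + ofReal m * y + b * z = y * lam ↔ _
    rw [ofReal_mul, eq_sub_iff_add_eq, eq_sub_iff_add_eq, add_right_comm]
  · change c * x + conj b * y + ofReal n * z = z * lam ↔ _
    rw [ofReal_mul, eq_sub_iff_add_eq, eq_sub_iff_add_eq]

end Octonion

open Octonion in
/-- With `λ = [x,y,z]` and `x ≠ 0`, the eigenvalue equation `A v = v λ` for the Jordan
matrix `A = !![p, a, conj c; conj a, m, b; c, conj b, n]` is equivalent to the solved
forms for `conj a` and `c` together with the master equation. -/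
theorem eigen_iff_master (p m n : ℝ) (a b c : Octonion) (x y z : Octonion) (hx : x ≠ 0) :
    Eig !![ofReal p, a, conj c; conj a, ofReal m, b; c, conj b, ofReal n]
        ![x, y, z] (assoc x y z) ↔
      (conj a = (normSq x)⁻¹ • ((y * (assoc x y z - ofReal m) - b * z) * conj x) ∧
       c = (normSq x)⁻¹ • ((z * (assoc x y z - ofReal n) - conj b * y) * conj x) ∧
       (x * (conj (assoc x y z) * conj y - conj z * conj b)) * y +
         (x * (conj (assoc x y z) * conj z - conj y * b)) * z -
         normSq x • (x * assoc x y z) =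
         (m * normSq y + n * normSq z - p * normSq x) • x) := by
  rw [eig_iff, mul_eq_iff_eq_smul_mul_conj hx, mul_eq_iff_eq_smul_mul_conj hx]
  constructor
  · rintro ⟨h₁, ha, hc⟩
    exact ⟨ha, hc, (first_row_iff_master hx ha hc).mp h₁⟩
  · rintro ⟨ha, hc, hm⟩
    exact ⟨(first_row_iff_master hx ha hc).mpr hm, ha, hc⟩
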